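/- Let A = ℚ[x₁,...,x_n]/(f₁,...,f_n) as above, B = ℚ[y₀]/(y₀^{2k}) with |y₀| = d, and F = ⊗_{i=1}^n ℚ[x_i]/(x_i^{a_i}). Then A is isomorphic as a graded B-module to B ⊗ F, via the map sending y₀^r ⊗ (x₁^{c₁}⋯x_n^{c_n}) to the class of x_n^{r·a_n}·x₁^{c₁}⋯x_n^{c_n}, where 0 ≤ c_i < a_i. -/

import Mathlib

set_option maxHeartbeats 1000000
set_option synthInstance.maxHeartbeats 1000000

open MvPolynomial
open scoped TensorProduct

theorem aux_lift {R M : Type*} [CommRing R] [Algebra ℚ R] [AddCommGroup M] [Module ℚ M]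
    {ι : Type*} (g : ι → R) (L : R →ₗ[ℚ] M) (h : ∀ p i, L (p * g i) = 0) :
    ∃ L' : (R ⧸ Ideal.span (Set.range g)) →ₗ[ℚ] M,
      ∀ x, L' (Ideal.Quotient.mk (Ideal.span (Set.range g)) x) = L x := by
  have key : ∀ x ∈ Ideal.span (Set.range g), L x = 0 := by
    intro x hx
    obtain ⟨c, rfl⟩ := Finsupp.mem_ideal_span_range_iff_exists_finsupp.1 hx
    rw [Finsupp.sum, map_sum]
    exact Finset.sum_eq_zero fun i _ => h _ _
  refine ⟨((Ideal.span (Set.range g)).restrictScalars ℚ).liftQ L (fun x hx => ?_) ∘ₗ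
    (Submodule.Quotient.restrictScalarsEquiv ℚ (Ideal.span (Set.range g))).symm.toLinearMap, ?_⟩
  · exact key x hx
  · intro x
    rfl

theorem aux_mod {n : ℕ} (a : Fin n → ℕ) (ha : ∀ i, 2 ≤ a i) (m : Fin n →₀ ℕ) (i : Fin n) :
    (∑ j, (m + Finsupp.single i (a i)) j / a j) = (∑ j, m j / a j) + 1 ∧
    ∀ j, (m + Finsupp.single i (a i)) j % a j = m j % a j := by
  constructor
  · have : ∀ j, (m + Finsupp.single i (a i)) j / a j = m j / a j + if j = i then 1 else 0 := by
      intro j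
      by_cases h : j = i
      · subst h
        have := ha j
        simp [Nat.add_div_right _ (show 0 < a j by omega)]
      · simp [h, Finsupp.single_apply, Ne.symm h]
    simp only [this, Finset.sum_add_distrib]
    simp
  · intro j
    by_cases h : j = i
    · subst h; simp
    · simp [Finsupp.single_apply, Ne.symm h]

theorem aux_A {n k : ℕ} (a : Fin n → ℕ)
    (lst : Fin n) (hlst : (lst : ℕ) = n - 1)
    (f : Fin n → MvPolynomial (Fin n) ℚ)
    (hf : ∀ i : Fin n, f i =
      if h : (i : ℕ) + 1 < n then
        X i ^ a i - X (⟨(i : ℕ) + 1, h⟩ : Fin n) ^ a (⟨(i : ℕ) + 1, h⟩ : Fin n)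
      else
        X i ^ (2 * k * a i)) :
    (∀ i, Ideal.Quotient.mk (Ideal.span (Set.range f)) (X i ^ a i) =
      Ideal.Quotient.mk (Ideal.span (Set.range f)) (X lst ^ a lst)) ∧
    Ideal.Quotient.mk (Ideal.span (Set.range f)) (X lst ^ a lst) ^ (2 * k) = 0 := by
  have hmem : ∀ i, Ideal.Quotient.mk (Ideal.span (Set.range f)) (f i) = 0 := fun i =>
    Ideal.Quotient.eq_zero_iff_mem.mpr (Ideal.subset_span ⟨i, rfl⟩)
  constructor
  · have : ∀ d : ℕ, ∀ i : Fin n, (i : ℕ) + d = n - 1 →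
      Ideal.Quotient.mk (Ideal.span (Set.range f)) (X i ^ a i) =
      Ideal.Quotient.mk (Ideal.span (Set.range f)) (X lst ^ a lst) := by
      intro d
      induction d with
      | zero =>
        intro i hi
        have : i = lst := Fin.ext (by omega)
        rw [this]
      | succ d ih =>
        intro i hi
        have h : (i : ℕ) + 1 < n := by omega
        have h1 := hmem i
        rw [hf i, dif_pos h, map_sub, sub_eq_zero] at h1
        rw [h1]
        exact ih ⟨(i : ℕ) + 1, h⟩ (by simp; omega)
    intro i
    exact this (n - 1 - i) i (by have := i.2; omega)
  · have h1 := hmem lst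
    rw [hf lst, dif_neg (by have := lst.2; omega)] at h1
    rw [← map_pow, ← pow_mul, mul_comm (a lst)]
    exact h1

theorem aux_monomial {n : ℕ} (m : Fin n →₀ ℕ) :
    (monomial m (1 : ℚ)) = ∏ i, (X i : MvPolynomial (Fin n) ℚ) ^ m i := by
  rw [MvPolynomial.monomial_eq]
  simp [Finsupp.prod_fintype]

theorem aux_core {n k : ℕ} {A B F : Type} [CommRing A] [CommRing B] [CommRing F]
    [Algebra ℚ A] [Algebra ℚ B] [Algebra ℚ F]
    (a : Fin n → ℕ) (ha : ∀ i, 2 ≤ a i) (lst : Fin n)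
    (f : Fin n → MvPolynomial (Fin n) ℚ)
    (hf : ∀ i : Fin n, f i =
      if h : (i : ℕ) + 1 < n then
        X i ^ a i - X (⟨(i : ℕ) + 1, h⟩ : Fin n) ^ a (⟨(i : ℕ) + 1, h⟩ : Fin n)
      else
        X i ^ (2 * k * a i))
    (mB : Polynomial ℚ →ₐ[ℚ] B) (sB : Function.Surjective mB)
    (mF : MvPolynomial (Fin n) ℚ →ₐ[ℚ] F) (sF : Function.Surjective mF)
    (mA : MvPolynomial (Fin n) ℚ →ₐ[ℚ] A) (sA : Function.Surjective mA)
    (y : B) (hy : y = mB Polynomial.X) (hy0 : y ^ (2 * k) = 0)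
    (z : A) (hz : z = mA (X lst ^ a lst)) (hA1 : ∀ i, mA (X i ^ a i) = z)
    (hF0 : ∀ i, mF (X i ^ a i) = 0)
    (bet : B →ₐ[ℚ] A) (hbet : bet y = z)
    (liftA : ∀ L : MvPolynomial (Fin n) ℚ →ₗ[ℚ] (B ⊗[ℚ] F), (∀ p i, L (p * f i) = 0) →
      ∃ L' : A →ₗ[ℚ] (B ⊗[ℚ] F), ∀ x, L' (mA x) = L x)
    (liftF : ∀ L : MvPolynomial (Fin n) ℚ →ₗ[ℚ] A, (∀ p i, L (p * X i ^ a i) = 0) →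
      ∃ L' : F →ₗ[ℚ] A, ∀ x, L' (mF x) = L x) :
    ∃ e : (B ⊗[ℚ] F) ≃ₗ[ℚ] A,
      (∀ (r : ℕ) (c : Fin n → ℕ), r < 2 * k → (∀ i, c i < a i) →
        e (mB (Polynomial.X ^ r) ⊗ₜ[ℚ] mF (∏ i : Fin n, (X i : MvPolynomial (Fin n) ℚ) ^ c i))
          = mA (X lst ^ (r * a lst) * ∏ i : Fin n, X i ^ c i)) ∧
      (∀ v, e ((mB Polynomial.X ⊗ₜ[ℚ] (1 : F)) * v) = mA (X lst ^ a lst) * e v) := by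
  -- the map from `A`
  let psi0 : MvPolynomial (Fin n) ℚ →ₗ[ℚ]
      (B ⊗[ℚ] F) :=
    (MvPolynomial.basisMonomials (Fin n) ℚ).constr ℚ fun m =>
      (y ^ (∑ j, m j / a j)) ⊗ₜ[ℚ] mF (∏ j, X j ^ (m j % a j))
  have hpsi0 : ∀ m : Fin n →₀ ℕ, psi0 (monomial m 1) =
      (y ^ (∑ j, m j / a j)) ⊗ₜ[ℚ] mF (∏ j, X j ^ (m j % a j)) := by
    intro m
    have := (MvPolynomial.basisMonomials (Fin n) ℚ).constr_basis ℚ (fun m =>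
      (y ^ (∑ j, m j / a j)) ⊗ₜ[ℚ] mF (∏ j, X j ^ (m j % a j))) m
    rwa [MvPolynomial.coe_basisMonomials] at this
  have hpsiX : ∀ i p, psi0 (p * X i ^ a i) = (y ⊗ₜ[ℚ] 1) * psi0 p := by
    intro i p
    have : psi0 ∘ₗ LinearMap.mulRight ℚ (X i ^ a i) =
        LinearMap.mulLeft ℚ (y ⊗ₜ[ℚ] (1 : F)) ∘ₗ psi0 := by
      refine (MvPolynomial.basisMonomials (Fin n) ℚ).ext fun m => ?_
      obtain ⟨h1, h2⟩ := aux_mod a ha m i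
      simp only [MvPolynomial.coe_basisMonomials, LinearMap.comp_apply, LinearMap.mulRight_apply,
        LinearMap.mulLeft_apply]
      rw [X_pow_eq_monomial, monomial_mul, one_mul, hpsi0, hpsi0, h1,
        Algebra.TensorProduct.tmul_mul_tmul, one_mul, pow_succ']
      simp only [h2]
    exact LinearMap.congr_fun this p
  have hpsiXr : ∀ i r p, psi0 (p * X i ^ (r * a i)) = ((y ^ r) ⊗ₜ[ℚ] 1) * psi0 p := by
    intro i r p
    induction r with
    | zero => simp [← Algebra.TensorProduct.one_def]
    | succ r ih =>
      rw [Nat.succ_mul, pow_add, ← mul_assoc, hpsiX, ih, ← mul_assoc,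
        Algebra.TensorProduct.tmul_mul_tmul, one_mul, pow_succ']
  obtain ⟨psi, hpsi⟩ := liftA psi0 (by
    intro p i
    rw [hf i]
    split_ifs with h
    · rw [mul_sub, map_sub, hpsiX, hpsiX, sub_self]
    · rw [hpsiXr, hy0, TensorProduct.zero_tmul, zero_mul])
  -- the map from `F`
  let gam0 : MvPolynomial (Fin n) ℚ →ₗ[ℚ] A :=
    (MvPolynomial.basisMonomials (Fin n) ℚ).constr ℚ fun m =>
      if ∀ i, m i < a i then mA (monomial m 1) else 0
  have hgam0 : ∀ m : Fin n →₀ ℕ, gam0 (monomial m 1) =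
      if ∀ i, m i < a i then mA (monomial m 1) else 0 := by
    intro m
    have := (MvPolynomial.basisMonomials (Fin n) ℚ).constr_basis ℚ (fun m =>
      if ∀ i, m i < a i then mA (monomial m 1) else 0) m
    rwa [MvPolynomial.coe_basisMonomials] at this
  obtain ⟨gam, hgam⟩ := liftF gam0 (by
    intro p i
    have : gam0 ∘ₗ LinearMap.mulRight ℚ (X i ^ a i) = 0 := by
      refine (MvPolynomial.basisMonomials (Fin n) ℚ).ext fun m => ?_
      simp only [MvPolynomial.coe_basisMonomials, LinearMap.comp_apply, LinearMap.mulRight_apply,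
        LinearMap.zero_apply]
      rw [X_pow_eq_monomial, monomial_mul, one_mul, hgam0, if_neg]
      intro h
      have := h i
      simp at this
    exact LinearMap.congr_fun this p)
  let phi : (B ⊗[ℚ] F) →ₗ[ℚ]
      A :=
    TensorProduct.lift ((LinearMap.mul ℚ A).compl₁₂ bet.toLinearMap gam)
  have hphi : ∀ b g, phi (b ⊗ₜ[ℚ] g) = bet b * gam g := fun b g => rfl
  have hgamc : ∀ c : Fin n → ℕ, (∀ i, c i < a i) →
      gam (mF (∏ i, X i ^ c i)) = mA (∏ i, X i ^ c i) := by
    intro c hc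
    have := aux_monomial (Finsupp.equivFunOnFinite.symm c)
    simp only [Finsupp.equivFunOnFinite_symm_apply_apply] at this
    rw [hgam, ← this, hgam0, if_pos]
    simpa using hc
  have h1 : phi ∘ₗ psi = LinearMap.id := by
    have h : ∀ p, phi (psi0 p) = mA p := by
      intro p
      have : phi ∘ₗ psi0 = mA.toLinearMap := by
        refine (MvPolynomial.basisMonomials (Fin n) ℚ).ext fun m => ?_
        simp only [MvPolynomial.coe_basisMonomials, LinearMap.comp_apply, AlgHom.toLinearMap_apply]
        rw [hpsi0, hphi, map_pow, hbet, hgamc _ (fun i => Nat.mod_lt _ (by have := ha i; omega)),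
          aux_monomial, map_prod, map_prod, ← Finset.prod_pow_eq_pow_sum, ← Finset.prod_mul_distrib]
        refine Finset.prod_congr rfl fun i _ => ?_
        rw [← hA1 i, ← map_pow, ← map_mul, ← pow_mul, ← pow_add, Nat.div_add_mod]
      exact LinearMap.congr_fun this p
    ext v
    obtain ⟨p, rfl⟩ := sA v
    rw [LinearMap.comp_apply, hpsi, h]; rfl
  have h2 : psi ∘ₗ phi = LinearMap.id := by
    have h : ∀ (r : ℕ) (p : MvPolynomial (Fin n) ℚ),
        psi (phi ((y ^ r) ⊗ₜ[ℚ] mF p)) = (y ^ r) ⊗ₜ[ℚ] mF p := by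
      intro r p
      have : psi ∘ₗ phi ∘ₗ (TensorProduct.mk ℚ _ _ (y ^ r)) ∘ₗ mF.toLinearMap
          = (TensorProduct.mk ℚ _ _ (y ^ r)) ∘ₗ mF.toLinearMap := by
        refine (MvPolynomial.basisMonomials (Fin n) ℚ).ext fun m => ?_
        simp only [MvPolynomial.coe_basisMonomials, LinearMap.comp_apply, AlgHom.toLinearMap_apply, TensorProduct.mk_apply]
        rw [hphi, map_pow, hbet, hgam, hgam0]
        split_ifs with hm
        · rw [hz, ← map_pow, ← map_mul, hpsi, mul_comm, ← pow_mul, mul_comm (a lst), hpsiXr, hpsi0,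
            Algebra.TensorProduct.tmul_mul_tmul, one_mul, aux_monomial]
          simp only [fun j => Nat.mod_eq_of_lt (hm j), fun j => Nat.div_eq_of_lt (hm j)]
          simp
        · rw [mul_zero, map_zero]
          push Not at hm
          obtain ⟨i, hi⟩ := hm
          have : mF (monomial m 1) = 0 := by
            rw [aux_monomial]
            refine zero_dvd_iff.1 (hF0 i ▸ map_dvd mF ?_)
            exact (pow_dvd_pow _ hi).trans
              (Finset.dvd_prod_of_mem (fun i => (X i : MvPolynomial (Fin n) ℚ) ^ m i)
                (Finset.mem_univ i))
          rw [this, TensorProduct.tmul_zero]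
      exact LinearMap.congr_fun this p
    refine TensorProduct.ext' fun b g => ?_
    obtain ⟨p, rfl⟩ := sF g
    obtain ⟨q, rfl⟩ := sB b
    induction q using Polynomial.induction_on' with
    | add q1 q2 e1 e2 => rw [map_add, TensorProduct.add_tmul, map_add, map_add, e1, e2]
    | monomial r c =>
      have : mB (Polynomial.monomial r c) = c • y ^ r := by
        rw [hy, ← map_pow, ← Polynomial.smul_X_eq_monomial, map_smul]
      rw [this, ← TensorProduct.smul_tmul', map_smul, map_smul, LinearMap.comp_apply, h]; rfl
  rw [← hy, ← hz]
  refine ⟨LinearEquiv.ofLinear phi psi h1 h2, ?_, ?_⟩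
  · intro r c hr hc
    rw [LinearEquiv.ofLinear_apply, hphi, map_pow, ← hy, map_pow, hbet, hgamc c hc, map_mul, hz,
      ← map_pow, ← pow_mul, mul_comm r]
  · intro v
    simp only [LinearEquiv.ofLinear_apply]
    induction v using TensorProduct.induction_on with
    | zero => simp
    | add v w e1 e2 => rw [mul_add, map_add, map_add, e1, e2, mul_add]
    | tmul b g => rw [Algebra.TensorProduct.tmul_mul_tmul, one_mul, hphi, hphi, map_mul, hbet, mul_assoc]

/-- `A = ℚ[x₁,…,x_n]/(f₁,…,f_n)` (with `f_i = x_i^{a_i} - x_{i+1}^{a_{i+1}}` for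
`i < n` and `f_n = x_n^{2k·a_n}`) is isomorphic, as a graded module over
`B = ℚ[y₀]/(y₀^{2k})` (where `y₀` acts as the class of `x_n^{a_n}`), to
`B ⊗ F` with `F = ⊗_i ℚ[x_i]/(x_i^{a_i})`, via
`y₀^r ⊗ x₁^{c₁}⋯x_n^{c_n} ↦ x_n^{r·a_n}·x₁^{c₁}⋯x_n^{c_n}` for `0 ≤ c_i < a_i`. -/
theorem stmt_10 (n k : ℕ) (hn : 2 ≤ n) (hk : 1 ≤ k)
    (a : Fin n → ℕ) (ha : ∀ i, 2 ≤ a i)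
    (lst : Fin n) (hlst : (lst : ℕ) = n - 1)
    (f : Fin n → MvPolynomial (Fin n) ℚ)
    (hf : ∀ i : Fin n, f i =
      if h : (i : ℕ) + 1 < n then
        X i ^ a i - X (⟨(i : ℕ) + 1, h⟩ : Fin n) ^ a (⟨(i : ℕ) + 1, h⟩ : Fin n)
      else
        X i ^ (2 * k * a i)) :
    ∃ e : ((Polynomial ℚ ⧸ Ideal.span {(Polynomial.X : Polynomial ℚ) ^ (2 * k)})
            ⊗[ℚ] (MvPolynomial (Fin n) ℚ ⧸
                    Ideal.span (Set.range fun i : Fin n => (X i : MvPolynomial (Fin n) ℚ) ^ a i)))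
          ≃ₗ[ℚ] (MvPolynomial (Fin n) ℚ ⧸ Ideal.span (Set.range f)),
      (∀ (r : ℕ) (c : Fin n → ℕ), r < 2 * k → (∀ i, c i < a i) →
        e (Ideal.Quotient.mk (Ideal.span {(Polynomial.X : Polynomial ℚ) ^ (2 * k)})
              ((Polynomial.X : Polynomial ℚ) ^ r) ⊗ₜ[ℚ]
            Ideal.Quotient.mk
              (Ideal.span (Set.range fun i : Fin n => (X i : MvPolynomial (Fin n) ℚ) ^ a i))
              (∏ i : Fin n, (X i : MvPolynomial (Fin n) ℚ) ^ c i))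
          = Ideal.Quotient.mk (Ideal.span (Set.range f))
              (X lst ^ (r * a lst) * ∏ i : Fin n, X i ^ c i))
      ∧
      (∀ v, e ((Ideal.Quotient.mk (Ideal.span {(Polynomial.X : Polynomial ℚ) ^ (2 * k)})
                  (Polynomial.X : Polynomial ℚ) ⊗ₜ[ℚ]
                (1 : MvPolynomial (Fin n) ℚ ⧸
                    Ideal.span (Set.range fun i : Fin n => (X i : MvPolynomial (Fin n) ℚ) ^ a i))) * v)
        = Ideal.Quotient.mk (Ideal.span (Set.range f))
            ((X lst : MvPolynomial (Fin n) ℚ) ^ a lst) * e v) := by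
  obtain ⟨hA1, hA2⟩ := aux_A a lst hlst f hf
  exact aux_core a ha lst f hf
    (Ideal.Quotient.mkₐ ℚ (Ideal.span {(Polynomial.X : Polynomial ℚ) ^ (2 * k)}))
    Ideal.Quotient.mk_surjective
    (Ideal.Quotient.mkₐ ℚ
      (Ideal.span (Set.range fun i : Fin n => (X i : MvPolynomial (Fin n) ℚ) ^ a i)))
    Ideal.Quotient.mk_surjective
    (Ideal.Quotient.mkₐ ℚ (Ideal.span (Set.range f)))
    Ideal.Quotient.mk_surjective
    _ rfl
    (by
      rw [← map_pow]
      exact Ideal.Quotient.eq_zero_iff_mem.mpr (Ideal.subset_span rfl))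
    _ rfl hA1
    (fun i => Ideal.Quotient.eq_zero_iff_mem.mpr (Ideal.subset_span ⟨i, rfl⟩))
    (Ideal.Quotient.liftₐ _
      (Polynomial.aeval (Ideal.Quotient.mk (Ideal.span (Set.range f)) (X lst ^ a lst))) (by
      intro x hx
      obtain ⟨c, rfl⟩ := Ideal.mem_span_singleton.1 hx
      rw [map_mul, map_pow, Polynomial.aeval_X, hA2, zero_mul]))
    (Polynomial.aeval_X (R := ℚ)
      (Ideal.Quotient.mk (Ideal.span (Set.range f)) (X lst ^ a lst)))
    (aux_lift f)
    (aux_lift (fun i : Fin n => (X i : MvPolynomial (Fin n) ℚ) ^ a i))
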